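/- For all integers m ≥ 3 and n ≥ 3, the Cartesian product W_m □ C_n of a wheel and a cycle satisfies tndi(W_m □ C_n) = Δ + 2 = m + 4, where Δ = m + 2 is the maximum degree of W_m □ C_n. -/

import Mathlib

open Finset SimpleGraph

/-- A neighbor-sum-distinguishing proper total `k`-coloring of `G`:
vertex colors `cv` and edge colors `ce` taken from `{1, …, k}`, proper on
vertices, edges, and incidences, and distinguishing adjacent vertices by the
total sum of colors at each vertex. -/
def IsProperTotalColoring {V : Type*} [Fintype V] (G : SimpleGraph V) (k : ℕ)
    (cv : V → ℕ) (ce : Sym2 V → ℕ) : Prop :=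
  (∀ v, cv v ∈ Finset.Icc 1 k) ∧
  (∀ u v, G.Adj u v → ce s(u, v) ∈ Finset.Icc 1 k) ∧
  (∀ u v, G.Adj u v → cv u ≠ cv v) ∧
  (∀ u v w, G.Adj u v → G.Adj u w → v ≠ w → ce s(u, v) ≠ ce s(u, w)) ∧
  (∀ u v, G.Adj u v → ce s(u, v) ≠ cv u ∧ ce s(u, v) ≠ cv v)

open Classical in
/-- The total color-sum at a vertex: the color of `v` plus the colors of all
edges incident with `v`. -/
noncomputable def totalSum {V : Type*} [Fintype V] (G : SimpleGraph V)
    (cv : V → ℕ) (ce : Sym2 V → ℕ) (v : V) : ℕ :=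
  cv v + ∑ w ∈ Finset.univ.filter (fun w => G.Adj v w), ce s(v, w)

/-- A neighbor-sum-distinguishing proper total `k`-coloring. -/
def IsNSDColoring {V : Type*} [Fintype V] (G : SimpleGraph V) (k : ℕ)
    (cv : V → ℕ) (ce : Sym2 V → ℕ) : Prop :=
  IsProperTotalColoring G k cv ce ∧
  ∀ u v, G.Adj u v → totalSum G cv ce u ≠ totalSum G cv ce v

/-- `tndi G` is the least `k` such that `G` admits a neighbor-sum-distinguishing
proper total `k`-coloring. -/
noncomputable def tndi {V : Type*} [Fintype V] (G : SimpleGraph V) : ℕ :=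
  sInf {k | ∃ cv ce, IsNSDColoring G k cv ce}

/-- The maximum degree of a finite simple graph. -/
noncomputable def maxDeg {V : Type*} [Fintype V] (G : SimpleGraph V) : ℕ :=
  @SimpleGraph.maxDegree V G _ (Classical.decRel _)

/-- The star `S_n = K_{1,n}` with center `0` and `n` leaves. -/
def starGraph (n : ℕ) : SimpleGraph (Fin (n + 1)) :=
  SimpleGraph.fromRel fun i _ => i = 0

/-- The wheel `W_m`: hub `0` joined to every vertex of the cycle on `1, …, m`. -/
def wheelGraph (m : ℕ) : SimpleGraph (Fin (m + 1)) :=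
  SimpleGraph.fromRel fun i j =>
    i = 0 ∨ (j.val = i.val + 1 ∧ 2 ≤ j.val) ∨ (i.val = m ∧ j.val = 1)

section TotalColoring

variable {V : Type*}

open Classical in
lemma totalSum_eq_sum_Icc [Fintype V] {G : SimpleGraph V} {k d : ℕ} {cv : V → ℕ}
    {ce : Sym2 V → ℕ} (hc : IsProperTotalColoring G k cv ce) (hk : k ≤ d + 1) {u : V}
    (hu : #{w | G.Adj u w} = d) :
    totalSum G cv ce u = ∑ x ∈ Icc 1 k, x := by
  obtain ⟨hv, he, -, hee, hev⟩ := hc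
  have hinj : Set.InjOn (fun w => ce s(u, w)) (({w | G.Adj u w} : Finset V) : Set V) := by
    intro a ha b hb hab
    by_contra hne
    exact hee u a b (by simpa using ha) (by simpa using hb) hne hab
  have hnot : cv u ∉ ({w | G.Adj u w} : Finset V).image (fun w => ce s(u, w)) := by
    simp only [mem_image, mem_filter, mem_univ, true_and, not_exists, not_and]
    exact fun w hw => (hev u w hw).1
  have hset : insert (cv u) (({w | G.Adj u w} : Finset V).image (fun w => ce s(u, w)))
      = Icc 1 k := by
    apply eq_of_subset_of_card_le
    · intro x hx
      simp only [mem_insert, mem_image, mem_filter, mem_univ, true_and] at hx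
      rcases hx with rfl | ⟨w, hw, rfl⟩
      · exact hv u
      · exact he u w hw
    · rw [card_insert_of_notMem hnot, card_image_of_injOn hinj, hu]
      simpa using hk
  rw [← hset, sum_insert hnot, sum_image hinj]
  rfl

open Classical in
lemma degree_add_two_le_of_adj [Fintype V] {G : SimpleGraph V} {k d : ℕ} {cv : V → ℕ}
    {ce : Sym2 V → ℕ} (hc : IsNSDColoring G k cv ce) {u v : V} (huv : G.Adj u v)
    (hu : #{w | G.Adj u w} = d) (hv : #{w | G.Adj v w} = d) : d + 2 ≤ k := by
  by_contra hk
  exact hc.2 u v huv ((totalSum_eq_sum_Icc hc.1 (by omega) hu).trans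
    (totalSum_eq_sum_Icc hc.1 (by omega) hv).symm)

/-- The edge coloring of `G □ C_n` with edges of the layer `j` colored by `ce j` and all edges
from layer `j` to layer `j + 1` colored `w j`. -/
def layeredEdgeColor {n : ℕ} [NeZero n] (ce : Fin n → Sym2 V → ℕ) (w : Fin n → ℕ) :
    Sym2 (V × Fin n) → ℕ :=
  Sym2.lift ⟨fun u v => if u.2 = v.2 then ce u.2 s(u.1, v.1) else
    (if v.2 = u.2 + 1 then w u.2 else 0) + (if u.2 = v.2 + 1 then w v.2 else 0), by
    rintro ⟨x, i⟩ ⟨y, j⟩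
    by_cases h : i = j
    · subst h
      simp [Sym2.eq_swap]
    · simp [h, Ne.symm h, add_comm]⟩

lemma Fin.add_one_add_one_ne_self {n : ℕ} (i : Fin (n + 3)) : i + 1 + 1 ≠ i := by
  rw [add_assoc, Ne, add_eq_left, Fin.ext_iff, Fin.val_add]
  simp [Nat.mod_eq_of_lt (show 2 < n + 3 by omega)]

section Layered

variable {n : ℕ} {ce : Fin (n + 3) → Sym2 V → ℕ} {w : Fin (n + 3) → ℕ}

lemma layeredEdgeColor_horizontal (x y : V) (i : Fin (n + 3)) :
    layeredEdgeColor ce w s((x, i), (y, i)) = ce i s(x, y) := by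
  simp [layeredEdgeColor]

lemma layeredEdgeColor_up (x : V) (i : Fin (n + 3)) :
    layeredEdgeColor ce w s((x, i), (x, i + 1)) = w i := by
  simp [layeredEdgeColor, (Fin.add_one_add_one_ne_self i).symm]

lemma layeredEdgeColor_down (x : V) (i : Fin (n + 3)) :
    layeredEdgeColor ce w s((x, i + 1), (x, i)) = w i := by
  rw [Sym2.eq_swap, layeredEdgeColor_up]

lemma boxProd_cycleGraph_adj {G : SimpleGraph V} {x y : V} {i j : Fin (n + 3)} :
    (G □ cycleGraph (n + 3)).Adj (x, i) (y, j) ↔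
      (G.Adj x y ∧ j = i) ∨ (y = x ∧ j = i + 1) ∨ (y = x ∧ i = j + 1) := by
  simp only [boxProd_adj, cycleGraph_adj, sub_eq_iff_eq_add, add_comm (1 : Fin (n + 3))]
  tauto

lemma totalSum_boxProd [Fintype V] {G : SimpleGraph V} (cv : Fin (n + 3) → V → ℕ) (x : V)
    (i : Fin (n + 3)) :
    totalSum (G □ cycleGraph (n + 3)) (fun v => cv v.2 v.1) (layeredEdgeColor ce w) (x, i + 1)
      = totalSum G (cv (i + 1)) (ce (i + 1)) x + (w i + w (i + 1)) := by
  classical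
  have hset : ({v | (G □ cycleGraph (n + 3)).Adj (x, i + 1) v} : Finset (V × Fin (n + 3)))
      = insert (x, i) (insert (x, i + 1 + 1)
        (({y | G.Adj x y} : Finset V).image fun y => (y, i + 1))) := by
    ext ⟨y, j⟩
    simp only [mem_filter, mem_univ, true_and, boxProd_cycleGraph_adj, mem_insert, mem_image,
      Prod.mk.injEq, add_left_inj]
    constructor
    · rintro (⟨h, rfl⟩ | ⟨rfl, rfl⟩ | ⟨rfl, rfl⟩) <;> simp [*]
    · rintro (⟨rfl, rfl⟩ | ⟨rfl, rfl⟩ | ⟨y, h, rfl, rfl⟩) <;> simp [*]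
  unfold totalSum
  rw [show (univ.filter fun v => (G □ cycleGraph (n + 3)).Adj (x, i + 1) v) = _ from hset,
    sum_insert, sum_insert, sum_image, layeredEdgeColor_down, layeredEdgeColor_up]
  · simp only [layeredEdgeColor_horizontal]
    ring
  · intro a _ b _ h
    simpa using h
  · simp
  · simp [(Fin.add_one_add_one_ne_self i).symm]

theorem exists_isNSDColoring_boxProd_cycleGraph [Fintype V] {G : SimpleGraph V} {k : ℕ}
    (cv : Fin (n + 3) → V → ℕ) (ce : Fin (n + 3) → Sym2 V → ℕ) (w : Fin (n + 3) → ℕ)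
    (hw : ∀ j, w j ∈ Icc 1 k) (hww : ∀ j, w j ≠ w (j + 1))
    (hc : ∀ j, IsNSDColoring G k (cv j) (ce j))
    (hvw : ∀ j v, cv j v ≠ w j ∧ cv (j + 1) v ≠ w j)
    (hew : ∀ j u v, G.Adj u v → ce j s(u, v) ≠ w j ∧ ce (j + 1) s(u, v) ≠ w j)
    (hcv : ∀ j v, cv j v ≠ cv (j + 1) v)
    (hsum : ∀ j v, totalSum G (cv (j + 1)) (ce (j + 1)) v + (w j + w (j + 1)) ≠
      totalSum G (cv (j + 1 + 1)) (ce (j + 1 + 1)) v + (w (j + 1) + w (j + 1 + 1))) :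
    ∃ cv ce, IsNSDColoring (G □ cycleGraph (n + 3)) k cv ce := by
  refine ⟨fun v => cv v.2 v.1, layeredEdgeColor ce w, ⟨fun v => (hc v.2).1.1 v.1, ?_, ?_, ?_, ?_⟩,
    ?_⟩
  · rintro ⟨x, i⟩ ⟨y, j⟩ h
    rcases boxProd_cycleGraph_adj.1 h with ⟨hG, rfl⟩ | ⟨rfl, rfl⟩ | ⟨rfl, rfl⟩
    · rw [layeredEdgeColor_horizontal]
      exact (hc _).1.2.1 x y hG
    · rw [layeredEdgeColor_up]
      exact hw _
    · rw [layeredEdgeColor_down]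
      exact hw _
  · rintro ⟨x, i⟩ ⟨y, j⟩ h
    rcases boxProd_cycleGraph_adj.1 h with ⟨hG, rfl⟩ | ⟨rfl, rfl⟩ | ⟨rfl, rfl⟩
    · exact (hc _).1.2.2.1 x y hG
    · exact hcv _ _
    · exact (hcv _ _).symm
  · rintro ⟨x, i⟩ ⟨y, j⟩ ⟨z, l⟩ h h' hne
    rcases boxProd_cycleGraph_adj.1 h with ⟨hG, rfl⟩ | ⟨rfl, rfl⟩ | ⟨rfl, rfl⟩ <;>
    rcases boxProd_cycleGraph_adj.1 h' with ⟨hG', hl⟩ | ⟨rfl, hl⟩ | ⟨rfl, hl⟩ <;>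
    first
    | subst hl
    | obtain rfl := add_right_cancel hl
    all_goals
      try simp only [layeredEdgeColor_horizontal, layeredEdgeColor_up, layeredEdgeColor_down]
    · exact (hc _).1.2.2.2.1 x y z hG hG' (by simpa using hne)
    · exact (hew _ _ _ hG).1
    · exact (hew _ _ _ hG).2
    · exact (hew _ _ _ hG').1.symm
    · exact absurd rfl hne
    · exact (hww _).symm
    · exact (hew _ _ _ hG').2.symm
    · exact hww _
    · exact absurd rfl hne
  · rintro ⟨x, i⟩ ⟨y, j⟩ h
    rcases boxProd_cycleGraph_adj.1 h with ⟨hG, rfl⟩ | ⟨rfl, rfl⟩ | ⟨rfl, rfl⟩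
    · rw [layeredEdgeColor_horizontal]
      exact (hc _).1.2.2.2.2 x y hG
    · rw [layeredEdgeColor_up]
      exact ⟨(hvw i y).1.symm, (hvw i y).2.symm⟩
    · rw [layeredEdgeColor_down]
      exact ⟨(hvw j y).2.symm, (hvw j y).1.symm⟩
  · rintro ⟨x, i⟩ ⟨y, j⟩ h
    rcases boxProd_cycleGraph_adj.1 h with ⟨hG, rfl⟩ | ⟨rfl, rfl⟩ | ⟨rfl, rfl⟩
    · obtain ⟨i, rfl⟩ : ∃ i', j = i' + 1 := ⟨j - 1, by simp⟩
      simp only [totalSum_boxProd]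
      have := (hc (i + 1)).2 x y hG
      omega
    · obtain ⟨i, rfl⟩ : ∃ i', i = i' + 1 := ⟨i - 1, by simp⟩
      simp only [totalSum_boxProd]
      exact hsum _ _
    · obtain ⟨i, rfl⟩ : ∃ i', j = i' + 1 := ⟨j - 1, by simp⟩
      simp only [totalSum_boxProd]
      exact (hsum _ _).symm

end Layered

end TotalColoring

section Wheel

/-- The successor of `p` in the cyclic order on `1, …, m`. -/
def rimNext (m p : ℕ) : ℕ := if p = m then 1 else p + 1

/-- The predecessor of `p` in the cyclic order on `1, …, m`. -/
def rimPrev (m p : ℕ) : ℕ := if p = 1 then m else p - 1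

lemma wheelGraph_adj {m : ℕ} (hm : 3 ≤ m) {u v : Fin (m + 1)} :
    (wheelGraph m).Adj u v ↔ (u.val = 0 ∧ v.val ≠ 0) ∨ (u.val ≠ 0 ∧ v.val = 0) ∨
      (u.val ≠ 0 ∧ v.val ≠ 0 ∧ v.val = rimNext m u) ∨
      (u.val ≠ 0 ∧ v.val ≠ 0 ∧ u.val = rimNext m v) := by
  have hu := u.isLt
  have hv := v.isLt
  simp only [wheelGraph, SimpleGraph.fromRel_adj, rimNext, Fin.ext_iff, Ne, Fin.val_zero]
  split_ifs <;> omega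

/-- A total coloring of a wheel: `hub` is the color of the hub, and the rim vertex `p` has color
`rim p`, its spoke has color `spoke p`, and the rim edge from `p` to its successor `arc p`. -/
structure WheelColoring where
  hub : ℕ
  spoke : ℕ → ℕ
  rim : ℕ → ℕ
  arc : ℕ → ℕ

namespace WheelColoring

variable (L L' : WheelColoring) (m : ℕ)

/-- The color of a vertex. -/
def vertexColor (v : Fin (m + 1)) : ℕ := if v.val = 0 then L.hub else L.rim v

/-- The color of the edge from `u` to `v` if it is a spoke leaving the hub or a rim edge in
positive direction, and `0` otherwise. -/
def dartColor (u v : Fin (m + 1)) : ℕ :=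
  if v.val = 0 then 0 else if u.val = 0 then L.spoke v else
    if v.val = rimNext m u then L.arc u else 0

/-- The color of an edge. -/
def edgeColor : Sym2 (Fin (m + 1)) → ℕ :=
  Sym2.lift ⟨fun u v => L.dartColor m u v + L.dartColor m v u, fun _ _ => add_comm _ _⟩

/-- The color sum at the hub. -/
def hubSum : ℕ := L.hub + ∑ p ∈ Icc 1 m, L.spoke p

/-- The color sum at the rim vertex `p`. -/
def rimSum (p : ℕ) : ℕ := L.rim p + L.spoke p + L.arc p + L.arc (rimPrev m p)

/-- The coloring is proper and neighbor-sum-distinguishing, and its colors belong to `S`. -/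
def IsGood (S : Finset ℕ) : Prop :=
  L.hub ∈ S ∧ (∀ p ∈ Icc 1 m, ∀ q ∈ Icc 1 m, p ≠ q → L.spoke p ≠ L.spoke q) ∧
  ∀ p ∈ Icc 1 m, (L.spoke p ∈ S ∧ L.rim p ∈ S ∧ L.arc p ∈ S) ∧
    L.spoke p ≠ L.hub ∧ L.rim p ≠ L.hub ∧ L.rim p ≠ L.spoke p ∧
    L.arc p ≠ L.rim p ∧ L.arc p ≠ L.rim (rimNext m p) ∧
    L.arc p ≠ L.spoke p ∧ L.arc p ≠ L.spoke (rimNext m p) ∧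
    L.rim p ≠ L.rim (rimNext m p) ∧ L.arc p ≠ L.arc (rimNext m p) ∧
    L.rimSum m p ≠ L.hubSum m ∧ L.rimSum m p ≠ L.rimSum m (rimNext m p)

/-- Two colorings are compatible if corresponding vertices have different colors and, once `x`
resp. `y` is added, different color sums. -/
def Compatible (x y : ℕ) : Prop :=
  L.hub ≠ L'.hub ∧ L.hubSum m + x ≠ L'.hubSum m + y ∧
  ∀ p ∈ Icc 1 m, L.rim p ≠ L'.rim p ∧ L.rimSum m p + x ≠ L'.rimSum m p + y

instance (S : Finset ℕ) : Decidable (L.IsGood m S) := by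
  unfold IsGood
  infer_instance

instance (x y : ℕ) : Decidable (L.Compatible L' m x y) := by
  unfold Compatible
  infer_instance

variable {L L' m}

lemma Compatible.symm {x y : ℕ} (h : L.Compatible L' m x y) : L'.Compatible L m y x :=
  ⟨h.1.symm, h.2.1.symm, fun p hp => ⟨(h.2.2 p hp).1.symm, (h.2.2 p hp).2.symm⟩⟩

lemma edgeColor_hub {u v : Fin (m + 1)} (hu : u.val = 0) (hv : v.val ≠ 0) :
    L.edgeColor m s(u, v) = L.spoke v := by
  simp only [edgeColor, dartColor, Sym2.lift_mk, hu, hv, if_true, if_false, add_zero]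

lemma edgeColor_next (hm : 3 ≤ m) {u v : Fin (m + 1)} (hu : u.val ≠ 0) (hv : v.val ≠ 0)
    (h : v.val = rimNext m u) : L.edgeColor m s(u, v) = L.arc u := by
  have h' : u.val ≠ rimNext m v := by
    have := u.isLt
    simp only [rimNext] at h ⊢
    split_ifs at h ⊢ <;> omega
  simp only [edgeColor, dartColor, Sym2.lift_mk, hu, hv, h', if_false]
  simp [h]

lemma edgeColor_cases (hm : 3 ≤ m) {u v : Fin (m + 1)} (h : (wheelGraph m).Adj u v) :
    (u.val = 0 ∧ v.val ∈ Icc 1 m ∧ L.edgeColor m s(u, v) = L.spoke v) ∨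
    (u.val ∈ Icc 1 m ∧ v.val = 0 ∧ L.edgeColor m s(u, v) = L.spoke u) ∨
    (u.val ∈ Icc 1 m ∧ v.val ∈ Icc 1 m ∧ v.val = rimNext m u ∧
      L.edgeColor m s(u, v) = L.arc u) ∨
    (u.val ∈ Icc 1 m ∧ v.val ∈ Icc 1 m ∧ u.val = rimNext m v ∧
      L.edgeColor m s(u, v) = L.arc v) := by
  have hu := u.isLt
  have hv := v.isLt
  have key : ∀ x : Fin (m + 1), x.val ≠ 0 → x.val ∈ Icc 1 m := fun x hx => by
    have := x.isLt
    rw [mem_Icc]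
    omega
  rcases (wheelGraph_adj hm).1 h with ⟨h0, h1⟩ | ⟨h0, h1⟩ | ⟨h0, h1, h2⟩ | ⟨h0, h1, h2⟩
  · exact .inl ⟨h0, key v h1, edgeColor_hub h0 h1⟩
  · exact .inr (.inl ⟨key u h0, h1, by rw [Sym2.eq_swap, edgeColor_hub h1 h0]⟩)
  · exact .inr (.inr (.inl ⟨key u h0, key v h1, h2, edgeColor_next hm h0 h1 h2⟩))
  · exact .inr (.inr (.inr ⟨key u h0, key v h1, h2, by
      rw [Sym2.eq_swap, edgeColor_next hm h1 h0 h2]⟩))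

lemma rimNext_injOn {p q : ℕ} (hp : p ∈ Icc 1 m) (hq : q ∈ Icc 1 m)
    (h : rimNext m p = rimNext m q) : p = q := by
  rw [mem_Icc] at hp hq
  simp only [rimNext] at h
  split_ifs at h <;> omega

open Classical in
lemma filter_adj_hub (hm : 3 ≤ m) {u : Fin (m + 1)} (hu : u.val = 0) :
    ({v | (wheelGraph m).Adj u v} : Finset (Fin (m + 1))) =
      ({v | v.val ≠ 0} : Finset (Fin (m + 1))) := by
  ext v
  simp [wheelGraph_adj hm, hu]

open Classical in
lemma filter_adj_rim (hm : 3 ≤ m) {u : Fin (m + 1)} (hu : u.val ≠ 0) :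
    ∃ v w : Fin (m + 1), v.val = rimNext m u ∧ w.val = rimPrev m u ∧ v.val ≠ 0 ∧ w.val ≠ 0 ∧
      v ≠ w ∧ u.val = rimNext m w ∧
      ({v | (wheelGraph m).Adj u v} : Finset (Fin (m + 1))) = {0, v, w} := by
  have hlt := u.isLt
  obtain ⟨h₁, h₂, h₃, h₄, h₅, h₆⟩ : rimNext m u < m + 1 ∧ rimPrev m u < m + 1 ∧
      rimNext m u ≠ 0 ∧ rimPrev m u ≠ 0 ∧ rimNext m u ≠ rimPrev m u ∧
      u.val = rimNext m (rimPrev m u) := by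
    simp only [rimNext, rimPrev]
    split_ifs <;> omega
  refine ⟨⟨rimNext m u, h₁⟩, ⟨rimPrev m u, h₂⟩, rfl, rfl, h₃, h₄, ?_, h₆, ?_⟩
  · rwa [Ne, Fin.mk.injEq]
  ext x
  have hx := x.isLt
  simp only [mem_filter, mem_univ, true_and, wheelGraph_adj hm, mem_insert, mem_singleton,
    Fin.ext_iff, Fin.val_zero, rimNext, rimPrev]
  split_ifs <;> omega

lemma sum_rim (f : ℕ → ℕ) :
    ∑ v ∈ ({v | v.val ≠ 0} : Finset (Fin (m + 1))), f v = ∑ p ∈ Icc 1 m, f p := by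
  refine sum_nbij Fin.val ?_ ?_ ?_ fun _ _ => rfl
  · intro v hv
    have := v.isLt
    simp only [mem_filter, mem_univ, true_and] at hv
    rw [mem_Icc]
    omega
  · exact Fin.val_injective.injOn
  · intro p hp
    rw [mem_coe, mem_Icc] at hp
    exact ⟨⟨p, by omega⟩, by simp; omega, rfl⟩

lemma totalSum_hub (hm : 3 ≤ m) {u : Fin (m + 1)} (hu : u.val = 0) :
    totalSum (wheelGraph m) (L.vertexColor m) (L.edgeColor m) u = L.hubSum m := by
  rw [totalSum, filter_adj_hub hm hu, hubSum, ← sum_rim]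
  congr 1
  · simp [vertexColor, hu]
  · refine sum_congr rfl fun v hv => edgeColor_hub hu (by simpa using hv)

lemma totalSum_rim (hm : 3 ≤ m) {u : Fin (m + 1)} (hu : u.val ≠ 0) :
    totalSum (wheelGraph m) (L.vertexColor m) (L.edgeColor m) u = L.rimSum m u := by
  obtain ⟨v, w, hv, hw, hv0, hw0, hvw, huw, hset⟩ := filter_adj_rim hm hu
  rw [totalSum, hset, sum_insert, sum_pair hvw, Sym2.eq_swap, edgeColor_hub rfl hu,
    edgeColor_next hm hu hv0 hv, Sym2.eq_swap, edgeColor_next hm hw0 hu huw, hw]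
  · simp only [vertexColor, hu, if_false, rimSum]
    ring
  · simp only [mem_insert, mem_singleton, Fin.ext_iff, Fin.val_zero]
    omega

theorem IsGood.isNSDColoring {k : ℕ} {S : Finset ℕ} (hm : 3 ≤ m) (h : L.IsGood m S)
    (hS : S ⊆ Icc 1 k) :
    IsNSDColoring (wheelGraph m) k (L.vertexColor m) (L.edgeColor m) := by
  obtain ⟨hhub, hinj, h⟩ := h
  refine ⟨⟨?_, ?_, ?_, ?_, ?_⟩, ?_⟩
  · intro v
    have := v.isLt
    unfold vertexColor
    split_ifs with hv
    · exact hS hhub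
    · exact hS (h v (mem_Icc.2 ⟨by omega, by omega⟩)).1.2.1
  · intro u v huv
    rcases edgeColor_cases (L := L) hm huv with ⟨_, hp, he⟩ | ⟨hp, _, he⟩ | ⟨hp, _, _, he⟩ |
      ⟨_, hp, _, he⟩ <;> rw [he]
    exacts [hS (h _ hp).1.1, hS (h _ hp).1.1, hS (h _ hp).1.2.2, hS (h _ hp).1.2.2]
  · intro u v huv
    rcases edgeColor_cases (L := L) hm huv with ⟨h0, hp, -⟩ | ⟨hp, h0, -⟩ | ⟨hp, hq, he, -⟩ |
      ⟨hp, hq, he, -⟩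
    · have := h _ hp
      have := (mem_Icc.1 hp).1
      grind [vertexColor]
    · have := h _ hp
      have := (mem_Icc.1 hp).1
      grind [vertexColor]
    · have := h _ hp
      have := (mem_Icc.1 hp).1
      have := (mem_Icc.1 hq).1
      grind [vertexColor]
    · have := h _ hq
      have := (mem_Icc.1 hp).1
      have := (mem_Icc.1 hq).1
      grind [vertexColor]
  · intro u v w huv huw hvw
    have hvw' : v.val ≠ w.val := fun h => hvw (Fin.ext h)
    rcases edgeColor_cases (L := L) hm huv with ⟨h0, hp, he⟩ | ⟨hp, h0, he⟩ | ⟨hp, hq, hn, he⟩ |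
      ⟨hp, hq, hn, he⟩ <;>
    rcases edgeColor_cases (L := L) hm huw with ⟨h0', hp', he'⟩ | ⟨hp', h0', he'⟩ |
      ⟨hp', hq', hn', he'⟩ | ⟨hp', hq', hn', he'⟩ <;> rw [he, he'] <;>
    first
    | exact hinj _ hp _ hp' hvw'
    | exact absurd (h0.trans h0'.symm) hvw'
    | exact absurd (hn.trans hn'.symm) hvw'
    | exact absurd (rimNext_injOn hq hq' (hn.symm.trans hn')) hvw'
    | (rw [mem_Icc] at *; omega)
    | grind
  · intro u v huv
    rcases edgeColor_cases (L := L) hm huv with ⟨h0, hp, he⟩ | ⟨hp, h0, he⟩ | ⟨hp, hq, hn, he⟩ |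
      ⟨hp, hq, hn, he⟩ <;> rw [he] <;> grind [vertexColor]
  · intro u v huv
    have key : ∀ x : Fin (m + 1), x.val ∈ Icc 1 m → x.val ≠ 0 := fun x hx => by
      rw [mem_Icc] at hx
      omega
    rcases edgeColor_cases (L := L) hm huv with ⟨h0, hp, -⟩ | ⟨hp, h0, -⟩ | ⟨hp, hq, hn, -⟩ |
      ⟨hp, hq, hn, -⟩
    · rw [totalSum_hub hm h0, totalSum_rim hm (key _ hp)]
      grind
    · rw [totalSum_hub hm h0, totalSum_rim hm (key _ hp)]
      grind
    · rw [totalSum_rim hm (key _ hp), totalSum_rim hm (key _ hq)]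
      grind
    · rw [totalSum_rim hm (key _ hp), totalSum_rim hm (key _ hq)]
      grind

lemma IsGood.vertexColor_mem {S : Finset ℕ} (h : L.IsGood m S) (v : Fin (m + 1)) :
    L.vertexColor m v ∈ S := by
  have := v.isLt
  unfold vertexColor
  split_ifs with hv
  · exact h.1
  · exact (h.2.2 v (mem_Icc.2 ⟨by omega, by omega⟩)).1.2.1

lemma IsGood.edgeColor_mem {S : Finset ℕ} (hm : 3 ≤ m) (h : L.IsGood m S) {u v : Fin (m + 1)}
    (huv : (wheelGraph m).Adj u v) : L.edgeColor m s(u, v) ∈ S := by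
  rcases edgeColor_cases (L := L) hm huv with ⟨_, hp, he⟩ | ⟨hp, _, he⟩ | ⟨hp, _, _, he⟩ |
    ⟨_, hp, _, he⟩ <;> rw [he]
  exacts [(h.2.2 _ hp).1.1, (h.2.2 _ hp).1.1, (h.2.2 _ hp).1.2.2, (h.2.2 _ hp).1.2.2]

lemma Compatible.vertexColor_ne {x y : ℕ} (h : L.Compatible L' m x y) (v : Fin (m + 1)) :
    L.vertexColor m v ≠ L'.vertexColor m v := by
  have := v.isLt
  unfold vertexColor
  split_ifs with hv
  · exact h.1
  · exact (h.2.2 v (mem_Icc.2 ⟨by omega, by omega⟩)).1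

lemma Compatible.totalSum_ne {x y : ℕ} (hm : 3 ≤ m) (h : L.Compatible L' m x y)
    (v : Fin (m + 1)) :
    totalSum (wheelGraph m) (L.vertexColor m) (L.edgeColor m) v + x ≠
      totalSum (wheelGraph m) (L'.vertexColor m) (L'.edgeColor m) v + y := by
  have := v.isLt
  by_cases hv : v.val = 0
  · rw [totalSum_hub hm hv, totalSum_hub hm hv]
    exact h.2.1
  · rw [totalSum_rim hm hv, totalSum_rim hm hv]
    exact (h.2.2 v (mem_Icc.2 ⟨by omega, by omega⟩)).2

end WheelColoring

end Wheel

section Patterns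

open WheelColoring

/-- Wheel colorings for the layers of a product with a cycle. The vertical edges leaving layers
of type `A₀` and `A`, `B`, `C` upwards are colored `a`, `b`, `c`; the layers are arranged
cyclically as `A, B, A, B, …` for even cycles and as `A₀, B, A, B, …, A, B, C` for odd cycles. -/
structure IsLayerPattern (m k a b c : ℕ) (A₀ A B C : WheelColoring) : Prop where
  mem : a ∈ Icc 1 k ∧ b ∈ Icc 1 k ∧ c ∈ Icc 1 k
  ne : a ≠ b ∧ b ≠ c ∧ c ≠ a
  goodA₀ : A₀.IsGood m (Icc 1 k \ {c, a})
  goodA : A.IsGood m (Icc 1 k \ {b, a})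
  goodB : B.IsGood m (Icc 1 k \ {a, b})
  goodC : C.IsGood m (Icc 1 k \ {b, c})
  compA₀B : A₀.Compatible B m (c + a) (a + b)
  compAB : A.Compatible B m (b + a) (a + b)
  compBC : B.Compatible C m (a + b) (b + c)
  compCA₀ : C.Compatible A₀ m (b + c) (c + a)

theorem exists_isNSDColoring_of_layers {m n k : ℕ} (hm : 3 ≤ m) (lay : Fin (n + 3) → WheelColoring)
    (w : Fin (n + 3) → ℕ) (hw : ∀ j, w j ∈ Icc 1 k) (hww : ∀ j, w j ≠ w (j + 1))
    (hgood : ∀ j, (lay (j + 1)).IsGood m (Icc 1 k \ {w j, w (j + 1)}))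
    (hcomp : ∀ j, (lay (j + 1)).Compatible (lay (j + 1 + 1)) m (w j + w (j + 1))
      (w (j + 1) + w (j + 1 + 1))) :
    ∃ cv ce, IsNSDColoring (wheelGraph m □ cycleGraph (n + 3)) k cv ce := by
  have hpred : ∀ j : Fin (n + 3), ∃ i, j = i + 1 := fun j => ⟨j - 1, by simp⟩
  refine exists_isNSDColoring_boxProd_cycleGraph (fun j => (lay j).vertexColor m)
    (fun j => (lay j).edgeColor m) w hw hww ?_ ?_ ?_ ?_ fun j => (hcomp j).totalSum_ne hm
  · intro j
    obtain ⟨i, rfl⟩ := hpred j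
    exact (hgood i).isNSDColoring hm sdiff_subset
  · intro j v
    obtain ⟨i, rfl⟩ := hpred j
    have h₁ := (hgood i).vertexColor_mem v
    have h₂ := (hgood (i + 1)).vertexColor_mem v
    simp only [mem_sdiff, mem_insert, mem_singleton, not_or] at h₁ h₂
    exact ⟨h₁.2.2, h₂.2.1⟩
  · intro j u v huv
    obtain ⟨i, rfl⟩ := hpred j
    have h₁ := (hgood i).edgeColor_mem hm huv
    have h₂ := (hgood (i + 1)).edgeColor_mem hm huv
    simp only [mem_sdiff, mem_insert, mem_singleton, not_or] at h₁ h₂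
    exact ⟨h₁.2.2, h₂.2.1⟩
  · intro j
    obtain ⟨i, rfl⟩ := hpred j
    exact (hcomp i).vertexColor_ne

lemma Fin.val_add_one' {n : ℕ} (j : Fin (n + 3)) :
    (j + 1).val = if j.val = n + 2 then 0 else j.val + 1 := by
  rw [Fin.val_add_one]
  simp [Fin.ext_iff]

theorem IsLayerPattern.exists_isNSDColoring {m k a b c n : ℕ} {A₀ A B C : WheelColoring}
    (hm : 3 ≤ m) (h : IsLayerPattern m k a b c A₀ A B C) :
    ∃ cv ce, IsNSDColoring (wheelGraph m □ cycleGraph (n + 3)) k cv ce := by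
  obtain ⟨⟨ha, hb, hc⟩, ⟨hab, hbc, hca⟩, gA₀, gA, gB, gC, cA₀B, cAB, cBC, cCA₀⟩ := h
  have cBA := cAB.symm
  by_cases hn : n % 2 = 1
  · let lay : ℕ → WheelColoring := fun j => if j % 2 = 0 then A else B
    let w : ℕ → ℕ := fun j => if j % 2 = 0 then a else b
    have hpar : ∀ j : Fin (n + 3), (j + 1).val % 2 = (j.val + 1) % 2 := fun j => by
      rw [Fin.val_add_one']
      split_ifs <;> omega
    refine exists_isNSDColoring_of_layers hm (fun j => lay j) (fun j => w j) ?_ ?_ ?_ ?_ <;>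
    intro j <;> have h₁ := hpar j <;> have h₂ := hpar (j + 1) <;>
    rcases Nat.mod_two_eq_zero_or_one j with h₀ | h₀
    all_goals
      have h₁' := h₁.trans (Nat.add_mod _ _ _)
      have h₂' := h₂.trans (Nat.add_mod _ _ _)
      simp only [h₀, Nat.reduceMod, Nat.reduceAdd] at h₁'
      simp only [h₁', Nat.reduceMod, Nat.reduceAdd] at h₂'
      simp only [lay, w, h₀, h₁', h₂', if_true, one_ne_zero, if_false]
      first | assumption | exact hab.symm
  · let lay : ℕ → WheelColoring := fun j =>
      if j = 0 then A₀ else if j = n + 2 then C else if j % 2 = 0 then A else B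
    let w : ℕ → ℕ := fun j => if j = n + 2 then c else if j % 2 = 0 then a else b
    have h0 : lay 0 = A₀ ∧ w 0 = a := by simp [lay, w]
    have hl : lay (n + 2) = C ∧ w (n + 2) = c := by simp [lay, w]
    have he : ∀ j, j ≠ 0 → j ≠ n + 2 → j % 2 = 0 → lay j = A ∧ w j = a := fun j h₁ h₂ h₃ => by
      simp [lay, w, h₁, h₂, h₃]
    have ho : ∀ j, j ≠ n + 2 → j % 2 = 1 → lay j = B ∧ w j = b := fun j h₂ h₃ => by
      have h₁ : j ≠ 0 := by omega
      simp [lay, w, h₁, h₂, h₃]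
    have key : ∀ j : Fin (n + 3),
        (w j = b ∧ lay (j + 1).val = C ∧ w (j + 1).val = c ∧
          lay (j + 1 + 1).val = A₀ ∧ w (j + 1 + 1).val = a) ∨
        (w j = c ∧ lay (j + 1).val = A₀ ∧ w (j + 1).val = a ∧
          lay (j + 1 + 1).val = B ∧ w (j + 1 + 1).val = b) ∨
        (w j = a ∧ lay (j + 1).val = B ∧ w (j + 1).val = b ∧
          lay (j + 1 + 1).val = C ∧ w (j + 1 + 1).val = c) ∨
        (w j = a ∧ lay (j + 1).val = B ∧ w (j + 1).val = b ∧
          lay (j + 1 + 1).val = A ∧ w (j + 1 + 1).val = a) ∨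
        (w j = b ∧ lay (j + 1).val = A ∧ w (j + 1).val = a ∧
          lay (j + 1 + 1).val = B ∧ w (j + 1 + 1).val = b) := fun j => by
      have hj := j.isLt
      rw [Fin.val_add_one' (j + 1), Fin.val_add_one' j]
      clear_value lay w
      generalize j.val = x at hj ⊢
      obtain rfl | rfl | rfl | hx : x = n + 2 ∨ x = n + 1 ∨ x = n ∨ x < n := by omega
      · obtain ⟨h₁, h₂⟩ := ho 1 (by omega) rfl
        simp [hl, h0, h₁, h₂]
      · obtain ⟨h₁, h₂⟩ := ho (n + 1) (by omega) (by omega)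
        simp [hl, h0, h₂]
      · obtain ⟨h₁, h₂⟩ := ho (x + 1) (by omega) (by omega)
        have h₃ : w x = a := by
          rcases Nat.eq_zero_or_pos x with rfl | hx
          · exact h0.2
          · exact (he x (by omega) (by omega) (by omega)).2
        simp [hl, h₁, h₂, h₃]
      · have e₁ : x ≠ n + 2 := by omega
        have e₂ : x + 1 ≠ n + 2 := by omega
        simp only [e₁, e₂, if_false]
        rcases Nat.mod_two_eq_zero_or_one x with hx' | hx'
        · obtain ⟨h₁, h₂⟩ := ho (x + 1) (by omega) (by omega)
          obtain ⟨h₄, h₅⟩ := he (x + 1 + 1) (by omega) (by omega) (by omega)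
          have h₃ : w x = a := by
            rcases Nat.eq_zero_or_pos x with rfl | hx
            · exact h0.2
            · exact (he x (by omega) (by omega) (by omega)).2
          simp [h₁, h₂, h₃, h₄, h₅]
        · obtain ⟨-, h₃⟩ := ho x (by omega) (by omega)
          obtain ⟨h₁, h₂⟩ := he (x + 1) (by omega) (by omega) (by omega)
          obtain ⟨h₄, h₅⟩ := ho (x + 1 + 1) (by omega) (by omega)
          simp [h₁, h₂, h₃, h₄, h₅]
    refine exists_isNSDColoring_of_layers hm (fun j => lay j) (fun j => w j) ?_ ?_ ?_ ?_ <;>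
    intro j <;>
    rcases key j with ⟨h₁, h₂, h₃, h₄, h₅⟩ | ⟨h₁, h₂, h₃, h₄, h₅⟩ | ⟨h₁, h₂, h₃, h₄, h₅⟩ |
      ⟨h₁, h₂, h₃, h₄, h₅⟩ | ⟨h₁, h₂, h₃, h₄, h₅⟩ <;>
    simp only [h₁, h₂, h₃, h₄, h₅] <;> first | assumption | exact hab.symm

/-- The `t`-th successor of `p` in the cyclic order on `1, …, m`. -/
def rimShift (m t p : ℕ) : ℕ := if p + t ≤ m then p + t else p + t - m

lemma sum_rimShift {m t : ℕ} (ht : t ≤ m) (f : ℕ → ℕ) :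
    ∑ p ∈ Icc 1 m, f (rimShift m t p) = ∑ p ∈ Icc 1 m, f p := by
  refine sum_nbij' (rimShift m t) (rimShift m (m - t)) ?_ ?_ ?_ ?_ fun _ _ => rfl <;>
  · intro p hp
    simp only [mem_Icc, rimShift] at hp ⊢
    split_ifs <;> omega

/-- The relabeling of colors that replaces `m` by `F`. -/
def relabel (m F q : ℕ) : ℕ := if q = m then F else q

lemma sum_relabel {m F : ℕ} (hm : 1 ≤ m) :
    ∑ p ∈ Icc 1 m, relabel m F p + m = ∑ p ∈ Icc 1 m, p + F := by
  obtain ⟨m, rfl⟩ := Nat.exists_eq_add_of_le' hm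
  have h : ∑ p ∈ Icc 1 m, relabel (m + 1) F p = ∑ p ∈ Icc 1 m, p := by
    refine sum_congr rfl fun p hp => if_neg ?_
    rw [mem_Icc] at hp
    omega
  rw [sum_Icc_succ_top (by omega), sum_Icc_succ_top (by omega), h, relabel, if_pos rfl]
  omega

/-- The wheel coloring whose rim edges alternate between `x` and `y`, up to one edge of color `5`
if `m` is odd, and whose spokes and rim vertices are colored by shifts of the rim order, with
the color `m` replaced by `F`. -/
def shiftColoring (m t hub x y F : ℕ) : WheelColoring where
  hub := hub
  spoke p := relabel m F (rimShift m t p)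
  rim p := relabel m F (rimShift m (t + 1) p)
  arc p := if p = m ∧ m % 2 = 1 then 5 else if p % 2 = 1 then x else y

lemma rimSum_shiftColoring {m t hub x y F p : ℕ} (hm : 3 ≤ m) (hp : p ∈ Icc 1 m) :
    (shiftColoring m t hub x y F).rimSum m p =
      relabel m F (rimShift m (t + 1) p) + relabel m F (rimShift m t p) +
        (if m % 2 = 1 ∧ p = m then 5 + y else if m % 2 = 1 ∧ p = 1 then x + 5 else x + y) := by
  rw [mem_Icc] at hp
  simp only [rimSum, shiftColoring, rimPrev]
  grind

lemma hubSum_shiftColoring {m t hub x y F : ℕ} (hm : 1 ≤ m) (ht : t ≤ m) :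
    (shiftColoring m t hub x y F).hubSum m + m = hub + F + ∑ p ∈ Icc 1 m, p := by
  have := sum_relabel (F := F) hm
  simp only [hubSum, shiftColoring, sum_rimShift ht]
  omega

lemma rimNext_mem {m p : ℕ} (hp : p ∈ Icc 1 m) : rimNext m p ∈ Icc 1 m := by
  simp only [rimNext, mem_Icc] at hp ⊢
  split_ifs <;> omega

lemma rimShift_mem {m t p : ℕ} (ht : t ≤ m) (hp : p ∈ Icc 1 m) : rimShift m t p ∈ Icc 1 m := by
  simp only [rimShift, mem_Icc] at hp ⊢
  split_ifs <;> omega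

lemma rimShift_rimNext {m t p : ℕ} (ht : t + 1 ≤ m) :
    rimShift m t (rimNext m p) = rimShift m (t + 1) p := by
  simp only [rimShift, rimNext]
  split_ifs <;> omega

lemma four_mul_le_sum_Icc {m : ℕ} (hm : 7 ≤ m) : 4 * m ≤ ∑ p ∈ Icc 1 m, p := by
  induction m, hm using Nat.le_induction with
  | base => decide
  | succ m hm ih =>
    rw [sum_Icc_succ_top (by omega)]
    omega

set_option maxHeartbeats 1000000 in
lemma isGood_shiftColoring {m t hub x y F : ℕ} {S : Finset ℕ} (hm : 7 ≤ m) (ht : t ≤ 2)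
    (hS : ∀ q, 1 ≤ q → q < m → q ∈ S) (hF : F ∈ S) (hh : hub ∈ S) (hx : x ∈ S) (hy : y ∈ S)
    (hF₁ : m ≤ F) (hF₂ : F ≤ m + 1) (hhub : m + 1 ≤ hub) (hx' : m + 1 ≤ x) (hy' : m ≤ y)
    (hFhub : F ≠ hub) (hFx : F ≠ x) (hFy : F ≠ y) (hxy : x ≠ y) (hsum : x + y ≤ 2 * m + 5)
    (hxy₁ : x + 2 < y + m) (hxy₂ : y ≠ x + 2) :
    (shiftColoring m t hub x y F).IsGood m S := by
  have hrel : ∀ q ∈ Icc 1 m, relabel m F q ∈ S ∧ relabel m F q ≠ hub ∧ relabel m F q ≠ x ∧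
      relabel m F q ≠ y ∧ (q = m ∧ relabel m F q = F ∨ q < m ∧ relabel m F q = q) := by
    intro q hq
    rw [mem_Icc] at hq
    rcases Nat.lt_or_ge q m with h | h
    · rw [relabel, if_neg (by omega)]
      exact ⟨hS q hq.1 h, by omega, by omega, by omega, by omega⟩
    · rw [relabel, if_pos (by omega)]
      exact ⟨hF, by omega, by omega, by omega, by omega⟩
  have hshift : ∀ s ≤ 4, ∀ p ∈ Icc 1 m, p + s ≤ m ∧ rimShift m s p = p + s ∨
      m < p + s ∧ rimShift m s p + m = p + s := by
    intro s hs p hp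
    rw [mem_Icc] at hp
    rw [rimShift]
    split_ifs <;> omega
  refine ⟨hh, ?_, ?_⟩
  · intro p hp q hq hpq
    have h₁ := (hrel _ (rimShift_mem (t := t) (by omega) hp)).2.2.2.2
    have h₂ := (hrel _ (rimShift_mem (t := t) (by omega) hq)).2.2.2.2
    have h₃ := hshift t (by omega) p hp
    have h₄ := hshift t (by omega) q hq
    rw [mem_Icc] at hp hq
    simp only [shiftColoring]
    omega
  intro p hp
  rw [rimSum_shiftColoring (by omega) hp, rimSum_shiftColoring (by omega) (rimNext_mem hp)]
  have hhs := hubSum_shiftColoring (m := m) (t := t) (hub := hub) (x := x) (y := y) (F := F)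
    (by omega) (by omega)
  have hsum' := four_mul_le_sum_Icc hm
  have hp' := mem_Icc.1 hp
  have harc : ∃ a, a = (shiftColoring m t hub x y F).arc p ∧ a ∈ S ∧
      (m % 2 = 1 ∧ p = m ∧ a = 5 ∨ a = x ∨ a = y) ∧
      a ≠ (shiftColoring m t hub x y F).arc (rimNext m p) := by
    refine ⟨_, rfl, ?_⟩
    have h5 := hS 5 (by omega) (by omega)
    simp only [shiftColoring, rimNext]
    grind
  obtain ⟨a, ha, haS, hax, han⟩ := harc
  rw [← ha]
  have hnext : p = m ∧ rimNext m p = 1 ∨ p < m ∧ rimNext m p = p + 1 := by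
    rw [rimNext]
    split_ifs <;> omega
  have e₀ : (shiftColoring m t hub x y F).hub = hub := rfl
  have e₁ : ∀ q, (shiftColoring m t hub x y F).spoke q = relabel m F (rimShift m t q) :=
    fun q => rfl
  have e₂ : ∀ q, (shiftColoring m t hub x y F).rim q = relabel m F (rimShift m (t + 1) q) :=
    fun q => rfl
  rw [e₀, e₁, e₁, e₂, e₂, rimShift_rimNext (by omega), rimShift_rimNext (by omega)]
  obtain ⟨h₁, h₂, h₃, h₄, h₅⟩ := hrel _ (rimShift_mem (t := t) (by omega) hp)
  obtain ⟨k₁, k₂, k₃, k₄, k₅⟩ := hrel _ (rimShift_mem (t := t + 1) (by omega) hp)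
  obtain ⟨l₁, l₂, l₃, l₄, l₅⟩ := hrel _ (rimShift_mem (t := t + 1 + 1) (by omega) hp)
  have h₆ := hshift t (by omega) p hp
  have k₆ := hshift (t + 1) (by omega) p hp
  have l₆ := hshift (t + 1 + 1) (by omega) p hp
  generalize relabel m F (rimShift m t p) = f₀ at *
  generalize relabel m F (rimShift m (t + 1) p) = f₁ at *
  generalize relabel m F (rimShift m (t + 1 + 1) p) = f₂ at *
  generalize rimShift m t p = s₀ at *
  generalize rimShift m (t + 1) p = s₁ at *
  generalize rimShift m (t + 1 + 1) p = s₂ at *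
  generalize rimNext m p = p' at *
  have hval : p + t + 2 < m ∧ f₀ = p + t ∧ f₁ = p + t + 1 ∧ f₂ = p + t + 2 ∨
      p + t + 2 = m ∧ f₀ + 2 = m ∧ f₁ + 1 = m ∧ f₂ = F ∨
      p + t + 1 = m ∧ f₀ + 1 = m ∧ f₁ = F ∧ f₂ = 1 ∨
      p + t = m ∧ f₀ = F ∧ f₁ = 1 ∧ f₂ = 2 ∨
      m < p + t ∧ f₀ + m = p + t ∧ f₁ = f₀ + 1 ∧ f₂ = f₀ + 2 := by
    obtain h | h | h | h | h :
        p + t + 2 < m ∨ p + t + 2 = m ∨ p + t + 1 = m ∨ p + t = m ∨ m < p + t := by omega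
    · exact .inl (by omega)
    · exact .inr (.inl (by omega))
    · exact .inr (.inr (.inl (by omega)))
    · exact .inr (.inr (.inr (.inl (by omega))))
    · exact .inr (.inr (.inr (.inr (by omega))))
  refine ⟨⟨h₁, k₁, haS⟩, h₂, k₂, ?_, ?_, ?_, ?_, ?_, ?_, han, ?_, ?_⟩ <;>
  clear h₅ k₅ l₅ h₆ k₆ l₆ <;> obtain h | h | h | h | h := hval
  all_goals first | omega | (split_ifs <;> omega)

theorem isLayerPattern_shiftColoring {m : ℕ} (hm : 7 ≤ m) :
    IsLayerPattern m (m + 4) (m + 2) (m + 3) (m + 4)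
      (shiftColoring m 0 (m + 1) (m + 3) (m + 1) m) (shiftColoring m 0 (m + 1) (m + 4) (m + 1) m)
      (shiftColoring m 1 (m + 4) (m + 4) (m + 1) m)
      (shiftColoring m 2 (m + 2) (m + 2) m (m + 1)) := by
  have hub := fun t h x y F (ht : t ≤ 2) =>
    hubSum_shiftColoring (m := m) (t := t) (hub := h) (x := x) (y := y) (F := F)
      (by omega) (by omega)
  have rim := fun t h x y F p (hp : p ∈ Icc 1 m) =>
    rimSum_shiftColoring (m := m) (t := t) (hub := h) (x := x) (y := y) (F := F) (by omega) hp
  refine ⟨?_, by omega, ?_, ?_, ?_, ?_, ?_, ?_, ?_, ?_⟩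
  · simp only [mem_Icc]
    omega
  iterate 4
    · apply isGood_shiftColoring hm <;> intros <;>
        first | omega | (simp only [mem_sdiff, mem_Icc, mem_insert, mem_singleton]; omega)
  all_goals
    refine ⟨by simp [shiftColoring], ?_, fun p hp => ⟨?_, ?_⟩⟩
    · have h₁ := hub 0 (m + 1) (m + 3) (m + 1) m (by omega)
      have h₂ := hub 0 (m + 1) (m + 4) (m + 1) m (by omega)
      have h₃ := hub 1 (m + 4) (m + 4) (m + 1) m (by omega)
      have h₄ := hub 2 (m + 2) (m + 2) m (m + 1) (by omega)
      omega
    · rw [mem_Icc] at hp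
      simp only [shiftColoring, relabel, rimShift]
      grind
    · rw [rim _ _ _ _ _ p hp, rim _ _ _ _ _ p hp]
      rw [mem_Icc] at hp
      simp only [relabel, rimShift]
      grind


/-- The wheel coloring given by lists of the colors of the spokes, rim vertices and rim edges. -/
def ofLists (hub : ℕ) (spokes rims arcs : List ℕ) : WheelColoring where
  hub := hub
  spoke p := spokes.getD (p - 1) 0
  rim p := rims.getD (p - 1) 0
  arc p := arcs.getD (p - 1) 0

theorem exists_isLayerPattern {m : ℕ} (hm : 3 ≤ m) :
    ∃ a b c A₀ A B C, IsLayerPattern m (m + 4) a b c A₀ A B C := by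
  obtain h | h := Nat.lt_or_ge m 7
  · interval_cases m
    · exact ⟨5, 6, 3,
        ofLists 6 [4, 7, 1] [1, 4, 2] [2, 6, 7],
        ofLists 7 [4, 3, 1] [2, 1, 4] [7, 2, 3],
        ofLists 1 [7, 3, 2] [4, 2, 7] [1, 4, 3],
        ofLists 4 [7, 2, 5] [5, 7, 1] [1, 4, 2],
        by decide, by decide, by decide, by decide, by decide, by decide, by decide, by decide,
        by decide, by decide⟩
    · exact ⟨6, 7, 8,
        ofLists 2 [1, 3, 7, 4] [5, 7, 5, 1] [2, 4, 2, 7],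
        ofLists 8 [2, 1, 5, 3] [3, 5, 4, 1] [8, 3, 2, 5],
        ofLists 3 [1, 5, 4, 8] [8, 4, 2, 5] [3, 8, 3, 2],
        ofLists 1 [6, 5, 2, 3] [4, 6, 3, 6] [2, 1, 5, 1],
        by decide, by decide, by decide, by decide, by decide, by decide, by decide, by decide,
        by decide, by decide⟩
    · exact ⟨7, 8, 9,
        ofLists 8 [6, 1, 2, 4, 5] [1, 3, 4, 5, 4] [2, 5, 6, 3, 8],
        ofLists 5 [2, 1, 3, 9, 6] [6, 3, 6, 4, 3] [9, 2, 5, 2, 1],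
        ofLists 3 [5, 9, 4, 1, 2] [4, 6, 1, 2, 6] [3, 2, 5, 9, 1],
        ofLists 1 [3, 5, 2, 4, 6] [6, 7, 5, 3, 7] [2, 6, 1, 5, 4],
        by decide, by decide, by decide, by decide, by decide, by decide, by decide, by decide,
        by decide, by decide⟩
    · exact ⟨8, 9, 10,
        ofLists 3 [2, 1, 6, 7, 5, 4] [6, 5, 9, 5, 2, 5] [4, 2, 3, 1, 9, 3],
        ofLists 6 [2, 10, 5, 4, 3, 7] [10, 4, 1, 5, 7, 2] [1, 2, 3, 6, 5, 3],
        ofLists 7 [10, 1, 4, 6, 3, 2] [5, 6, 10, 2, 10, 6] [4, 5, 1, 4, 7, 3],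
        ofLists 4 [3, 5, 8, 2, 7, 1] [2, 3, 6, 8, 5, 3] [6, 2, 1, 3, 8, 7],
        by decide, by decide, by decide, by decide, by decide, by decide, by decide, by decide,
        by decide, by decide⟩
  · exact ⟨_, _, _, _, _, _, _, isLayerPattern_shiftColoring h⟩

end Patterns

section Degree

open Classical in
lemma card_filter_wheelGraph_adj_hub {m : ℕ} (hm : 3 ≤ m) {u : Fin (m + 1)} (hu : u.val = 0) :
    #{v | (wheelGraph m).Adj u v} = m := by
  rw [WheelColoring.filter_adj_hub hm hu, filter_not,
    show ({v | v.val = 0} : Finset (Fin (m + 1))) = {0} by ext; simp,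
    card_sdiff_of_subset (subset_univ _)]
  simp

open Classical in
lemma card_filter_wheelGraph_adj_le {m : ℕ} (hm : 3 ≤ m) (u : Fin (m + 1)) :
    #{v | (wheelGraph m).Adj u v} ≤ m := by
  by_cases hu : u.val = 0
  · exact (card_filter_wheelGraph_adj_hub hm hu).le
  · obtain ⟨v, w, -, -, -, -, -, -, hset⟩ := WheelColoring.filter_adj_rim hm hu
    rw [hset]
    exact card_le_three.trans hm

open Classical in
lemma degree_eq_card_filter {V : Type*} [Fintype V] (G : SimpleGraph V) (v : V)
    [Fintype (G.neighborSet v)] : G.degree v = #{w | G.Adj v w} := by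
  rw [← card_neighborFinset_eq_degree]
  congr 1
  ext
  simp

open Classical in
lemma card_filter_boxProd_cycleGraph_adj {V : Type*} [Fintype V] {G : SimpleGraph V} {n : ℕ}
    (v : V × Fin (n + 3)) :
    #{w | (G □ cycleGraph (n + 3)).Adj v w} = #{x | G.Adj v.1 x} + 2 := by
  rw [← degree_eq_card_filter, ← degree_eq_card_filter, degree_boxProd, cycleGraph_degree_three_le]

theorem maxDeg_wheelGraph_boxProd_cycleGraph {m n : ℕ} (hm : 3 ≤ m) :
    maxDeg (wheelGraph m □ cycleGraph (n + 3)) = m + 2 := by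
  let _ := Classical.decRel (wheelGraph m □ cycleGraph (n + 3)).Adj
  refine le_antisymm (maxDegree_le_of_forall_degree_le _ _ fun v => ?_) ?_
  · rw [degree_eq_card_filter, card_filter_boxProd_cycleGraph_adj]
    exact Nat.add_le_add_right (card_filter_wheelGraph_adj_le hm v.1) 2
  · refine le_trans ?_ (degree_le_maxDegree (wheelGraph m □ cycleGraph (n + 3)) (0, 0))
    rw [degree_eq_card_filter, card_filter_boxProd_cycleGraph_adj,
      card_filter_wheelGraph_adj_hub hm rfl]

end Degree

theorem stmt_7 (m n : ℕ) (hm : 3 ≤ m) (hn : 3 ≤ n) :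
    maxDeg ((wheelGraph m).boxProd (cycleGraph n)) = m + 2 ∧
    tndi ((wheelGraph m).boxProd (cycleGraph n)) = m + 4 := by
  classical
  obtain ⟨n, rfl⟩ := Nat.exists_eq_add_of_le' hn
  refine ⟨maxDeg_wheelGraph_boxProd_cycleGraph hm, ?_⟩
  obtain ⟨a, b, c, A₀, A, B, C, h⟩ := exists_isLayerPattern hm
  have hmem := h.exists_isNSDColoring (n := n) hm
  refine le_antisymm (Nat.sInf_le hmem) (le_csInf ⟨m + 4, hmem⟩ ?_)
  rintro k ⟨cv, ce, hc⟩
  have hcard : ∀ i, #{w | (wheelGraph m □ cycleGraph (n + 3)).Adj (0, i) w} = m + 2 := fun i => by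
    rw [card_filter_boxProd_cycleGraph_adj, card_filter_wheelGraph_adj_hub hm rfl]
  refine degree_add_two_le_of_adj hc (u := (0, 0)) (v := (0, 1)) ?_ ?_ ?_
  · exact boxProd_cycleGraph_adj.2 (.inr (.inl ⟨rfl, by simp⟩))
  · convert hcard 0
  · convert hcard 1
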